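/- Let A be a commutative ring, I = (x_1, …, x_n) a finitely generated ideal, and M an A-module. Then every element of M is annihilated by some power of I if and only if for each i with 1 ≤ i ≤ n the localization M[x_i^{-1}] (the localization of M away from x_i, i.e., M ⊗_A A[x_i^{-1}]) is the zero module. -/

import Mathlib

/-- Let `A` be a commutative ring, `I = (x_1, …, x_n)` a finitely generated
ideal, and `M` an `A`-module. Then every element of `M` is annihilated by some power of `I`
if and only if for each `i` the localization `M[x_i⁻¹]` of `M` away from `x_i` is zero. -/
theorem statement4 {A : Type*} [CommRing A] {M : Type*} [AddCommGroup M] [Module A M]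
    {n : ℕ} (x : Fin n → A) (I : Ideal A) (hI : I = Ideal.span (Set.range x)) :
    (∀ m : M, ∃ k : ℕ, ∀ a ∈ I ^ k, a • m = 0) ↔
      ∀ i : Fin n, Subsingleton (LocalizedModule (Submonoid.powers (x i)) M) := by
  simp only [LocalizedModule.subsingleton_iff, Submonoid.mem_powers_iff]
  subst hI
  constructor
  · intro h i m
    obtain ⟨k, hk⟩ := h m
    exact ⟨x i ^ k, ⟨k, rfl⟩,
      hk _ (Ideal.pow_mem_pow (Ideal.subset_span (Set.mem_range_self i)) k)⟩
  · intro h m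
    have hrad : Ideal.span (Set.range x) ≤
        Ideal.radical (LinearMap.toSpanSingleton A M m).ker := by
      rw [Ideal.span_le]
      rintro _ ⟨i, rfl⟩
      obtain ⟨_, ⟨k, rfl⟩, hk⟩ := h i m
      exact ⟨k, by simpa using hk⟩
    obtain ⟨k, hk⟩ := Ideal.exists_pow_le_of_le_radical_of_fg hrad
      (Submodule.fg_span (Set.finite_range x))
    exact ⟨k, fun a ha => by simpa using hk ha⟩
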